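/- Let φ : Σ* → Σ* be a nonerasing morphism, b ∈ Σ a letter, and γ ∈ Σ* a finite word such that γ·b is a prefix of φ(b) and φ(φ(γ)) = φ(γ). Then for every k ≥ 1 the word φ(γ)^(k−1)·γ·b (the word φ(γ) repeated k − 1 times, followed by γ, followed by b) is a prefix of φ^k(b). Symmetrically, if b·γ is a suffix of φ(b) and φ(φ(γ)) = φ(γ), then for every k ≥ 1 the word b·γ·φ(γ)^(k−1) is a suffix of φ^k(b). -/

import Mathlib

/-- Apply a morphism (given by its values on letters) to a finite word. -/
def substWord {A : Type*} (φ : A → List A) : List A → List A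
  | [] => []
  | a :: w => φ a ++ substWord φ w

/-- The `n`-th iterate of a morphism applied to a word. -/
def iterWord {A : Type*} (φ : A → List A) (n : ℕ) (w : List A) : List A :=
  (substWord φ)^[n] w

/-- The word `lam` repeated `n` times. -/
def repWord {A : Type*} : ℕ → List A → List A
  | 0, _ => []
  | n + 1, lam => lam ++ repWord n lam

theorem substWord_append {A : Type*} (φ : A → List A) (u v : List A) :
    substWord φ (u ++ v) = substWord φ u ++ substWord φ v := by
  induction u with
  | nil => rfl
  | cons a u ih => simp [substWord, ih]

theorem substWord_singleton {A : Type*} (φ : A → List A) (a : A) :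
    substWord φ [a] = φ a := by
  simp [substWord]

theorem substWord_repWord {A : Type*} (φ : A → List A) (n : ℕ) (w : List A) :
    substWord φ (repWord n w) = repWord n (substWord φ w) := by
  induction n with
  | zero => rfl
  | succ n ih => simp [repWord, substWord_append, ih]

theorem repWord_append_self {A : Type*} (n : ℕ) (w : List A) :
    repWord n w ++ w = w ++ repWord n w := by
  induction n with
  | zero => simp [repWord]
  | succ n ih => simp [repWord, ih]

theorem substWord_prefix {A : Type*} (φ : A → List A) {u v : List A} (h : u <+: v) :
    substWord φ u <+: substWord φ v := by
  obtain ⟨t, rfl⟩ := h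
  exact ⟨substWord φ t, (substWord_append φ u t).symm⟩

theorem substWord_suffix {A : Type*} (φ : A → List A) {u v : List A} (h : u <:+ v) :
    substWord φ u <:+ substWord φ v := by
  obtain ⟨t, rfl⟩ := h
  exact ⟨substWord φ t, (substWord_append φ t u).symm⟩

theorem iterWord_succ {A : Type*} (φ : A → List A) (n : ℕ) (w : List A) :
    iterWord φ (n + 1) w = substWord φ (iterWord φ n w) :=
  Function.iterate_succ_apply' _ _ _

/-- If `γ·b` is a prefix of `φ(b)` and `φ(φ(γ)) = φ(γ)`, then for every
`k ≥ 1` the word `φ(γ)^(k−1)·γ·b` is a prefix of `φ^k(b)`; symmetrically, if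
`b·γ` is a suffix of `φ(b)` and `φ(φ(γ)) = φ(γ)`, then `b·γ·φ(γ)^(k−1)` is a
suffix of `φ^k(b)`. -/
theorem stmt11 {A : Type*} (φ : A → List A)
    (hφ : ∀ c : A, φ c ≠ []) (b : A) (γ : List A)
    (hfix : substWord φ (substWord φ γ) = substWord φ γ) :
    ((γ ++ [b] <+: φ b) → ∀ k : ℕ, 1 ≤ k →
        repWord (k - 1) (substWord φ γ) ++ γ ++ [b] <+: iterWord φ k [b]) ∧
    ((b :: γ <:+ φ b) → ∀ k : ℕ, 1 ≤ k →
        b :: (γ ++ repWord (k - 1) (substWord φ γ)) <:+ iterWord φ k [b]) := by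
  constructor
  · intro h k hk
    induction k, hk using Nat.le_induction with
    | base => simpa [repWord, iterWord, substWord] using h
    | succ k hk ih =>
      obtain ⟨n, rfl⟩ := Nat.exists_eq_add_of_le' hk
      rw [iterWord_succ]
      refine List.IsPrefix.trans ?_ (substWord_prefix φ ih)
      simp only [Nat.add_sub_cancel, substWord_append, substWord_repWord, hfix,
        substWord_singleton, repWord_append_self, repWord]
      rw [List.append_assoc _ γ]
      exact (List.prefix_append_right_inj _).2 h
  · intro h k hk
    induction k, hk using Nat.le_induction with
    | base => simpa [repWord, iterWord, substWord] using h
    | succ k hk ih =>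
      obtain ⟨n, rfl⟩ := Nat.exists_eq_add_of_le' hk
      rw [iterWord_succ]
      refine List.IsSuffix.trans ?_ (substWord_suffix φ ih)
      simp only [Nat.add_sub_cancel, substWord, substWord_append, substWord_repWord, hfix,
        repWord]
      rw [← List.cons_append]
      obtain ⟨t, ht⟩ := h
      exact ⟨t, by rw [← ht, List.append_assoc]⟩
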